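/- Let K = ℂ(t) be the field of rational functions in one variable over ℂ (RatFunc ℂ). In the polynomial ring K[x,y], set f₇ = x³ + ¼(t⁴ − 6t³ + 3t² + 2t + 1)x² + ½(t⁵ − 2t⁴ + t²)x + ¼(t⁶ − 2t⁵ + t⁴) and w = (t³ − t²)/2, and set g₁ = −4x³ + (−t⁴ + 6t³ − 3t² − 2t − 1)x² + (−2t⁵ + 4t⁴ − 2t²)x + 4y² − t⁶ + 2t⁵ − t⁴, g₂ = (−t² + 3t + 3)x³ + 2x²y + (−3t³ + 4t² + 3t + 1)x² + (4t + 2)xy + (−3t⁴ + 2t³ + 2t²)x + 2t²y − t⁵ + t⁴, g₃ = 2x⁵ + (−4t − 2)x⁴ + (6t² + 8t + 2)x³ + (−t⁵ − 3t⁴ + 8t³ + 12t² + 6t + 1)x² + (2t³ + 12t² + 10t + 2)xy + (−2t⁶ − 7t⁵ + 4t⁴ + 8t³ + 2t²)x + (2t⁴ + 6t³ + 2t²)y − t⁷ − 2t⁶ + 2t⁵ + t⁴. Then the ideal of K[x,y] generated by {x⁷, x⁶(y − w), x⁵(y − w)², x⁴(y − w)³, x³(y − w)⁴, x²(y − w)⁵,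 x(y − w)⁶, (y − w)⁷, y² − f₇} is equal to the ideal generated by {g₁, g₂, g₃}. -/

import Mathlib

open MvPolynomial

noncomputable abbrev K13 := RatFunc ℂ
noncomputable abbrev tm : MvPolynomial (Fin 2) K13 := C RatFunc.X
noncomputable abbrev xm : MvPolynomial (Fin 2) K13 := MvPolynomial.X 0
noncomputable abbrev ym : MvPolynomial (Fin 2) K13 := MvPolynomial.X 1

/-- `f₇ = x³ + ¼(t⁴ − 6t³ + 3t² + 2t + 1)x² + ½(t⁵ − 2t⁴ + t²)x + ¼(t⁶ − 2t⁵ + t⁴)`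
in `K[x,y]`. -/
noncomputable def f₇₁₃ : MvPolynomial (Fin 2) K13 :=
  xm ^ 3 + C (1 / 4 : K13) * (tm ^ 4 - 6 * tm ^ 3 + 3 * tm ^ 2 + 2 * tm + 1) * xm ^ 2 +
    C (1 / 2 : K13) * (tm ^ 5 - 2 * tm ^ 4 + tm ^ 2) * xm +
    C (1 / 4 : K13) * (tm ^ 6 - 2 * tm ^ 5 + tm ^ 4)

/-- `w = (t³ − t²)/2` regarded as a constant of `K[x,y]`. -/
noncomputable def w₁₃ : MvPolynomial (Fin 2) K13 :=
  C ((RatFunc.X ^ 3 - RatFunc.X ^ 2) / 2 : K13)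

section PowersOfPoint

variable {R : Type*} [CommRing R]

theorem add_pow_mem_of_monomials_mem {I : Ideal R} {x v : R} {n : ℕ}
    (h : ∀ i ≤ n, x ^ i * v ^ (n - i) ∈ I) (a b : R) : (a * x + b * v) ^ n ∈ I := by
  rw [add_pow]
  refine I.sum_mem fun i hi => ?_
  have hi' : i ≤ n := Nat.lt_succ_iff.mp (Finset.mem_range.mp hi)
  have := I.mul_mem_left (a ^ i * b ^ (n - i) * (n.choose i : R)) (h i hi')
  convert this using 1
  rw [mul_pow, mul_pow]
  ring

theorem mem_of_mul_mem_of_monomials_mem {I : Ideal R} {x v : R} {n : ℕ}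
    (h : ∀ i ≤ n, x ^ i * v ^ (n - i) ∈ I) {c g g' a b : R} (hc : IsUnit c)
    (hg' : g' = c + (a * x + b * v)) (hg : g * g' ∈ I) : g ∈ I := by
  obtain ⟨d, hd⟩ := sub_dvd_pow_sub_pow c (-(a * x + b * v)) n
  have hpow : (-(a * x + b * v)) ^ n ∈ I := by
    simpa only [neg_mul, neg_add] using add_pow_mem_of_monomials_mem h (-a) (-b)
  rw [← Ideal.unit_mul_mem_iff_mem I (hc.pow n)]
  have key : c ^ n * g = g * g' * d + g * (-(a * x + b * v)) ^ n := by
    rw [hg']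
    linear_combination g * hd
  rw [key]
  exact I.add_mem (I.mul_mem_right _ hg) (I.mul_mem_left _ hpow)

theorem monomial_mem_of_pow_mem {J : Ideal R} {x v u q : R} {n : ℕ} (hu : IsUnit u)
    (hx : x ^ n ∈ J) (hv : u * v - x * q ∈ J) {i : ℕ} (hi : i ≤ n) :
    x ^ i * v ^ (n - i) ∈ J := by
  obtain ⟨d, hd⟩ := sub_dvd_pow_sub_pow (u * v) (x * q) (n - i)
  rw [← Ideal.unit_mul_mem_iff_mem J (hu.pow (n - i))]
  have hxn : x ^ i * x ^ (n - i) = x ^ n := by rw [← pow_add, Nat.add_sub_cancel' hi]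
  have key : u ^ (n - i) * (x ^ i * v ^ (n - i)) =
      x ^ i * d * (u * v - x * q) + q ^ (n - i) * x ^ n := by
    rw [mul_pow, mul_pow] at hd
    linear_combination x ^ i * hd + q ^ (n - i) * hxn
  rw [key]
  exact J.add_mem (J.mul_mem_left _ hv) (J.mul_mem_left _ hx)

end PowersOfPoint

theorem four_mul_curve : 4 * (ym ^ 2 - f₇₁₃) =
    -4 * xm ^ 3 + (-tm ^ 4 + 6 * tm ^ 3 - 3 * tm ^ 2 - 2 * tm - 1) * xm ^ 2 +
      (-2 * tm ^ 5 + 4 * tm ^ 4 - 2 * tm ^ 2) * xm + 4 * ym ^ 2 - tm ^ 6 +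
      2 * tm ^ 5 - tm ^ 4 := by
  have h4 : 4 * (C (1 / 4 : K13) : MvPolynomial (Fin 2) K13) = 1 := by
    rw [show (4 : MvPolynomial (Fin 2) K13) = C 4 from (map_ofNat C 4).symm, ← C_mul]
    norm_num
  have h2 : 2 * (C (1 / 2 : K13) : MvPolynomial (Fin 2) K13) = 1 := by
    rw [show (2 : MvPolynomial (Fin 2) K13) = C 2 from (map_ofNat C 2).symm, ← C_mul]
    norm_num
  unfold f₇₁₃
  linear_combination
    -((tm ^ 4 - 6 * tm ^ 3 + 3 * tm ^ 2 + 2 * tm + 1) * xm ^ 2 +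
      (tm ^ 6 - 2 * tm ^ 5 + tm ^ 4)) * h4 -
    2 * (tm ^ 5 - 2 * tm ^ 4 + tm ^ 2) * xm * h2

theorem two_mul_w : 2 * w₁₃ = tm ^ 3 - tm ^ 2 := by
  unfold w₁₃ tm
  rw [show (2 : MvPolynomial (Fin 2) K13) = C 2 from (map_ofNat C 2).symm, ← C_mul,
    ← C_pow, ← C_pow, ← C_sub]
  congr 1
  ring

theorem isUnit_C_of_ne_zero {a : K13} (ha : a ≠ 0) :
    IsUnit (C a : MvPolynomial (Fin 2) K13) :=
  (isUnit_iff_ne_zero.mpr ha).map C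

theorem isUnit_ofNat_mvPolynomial (n : ℕ) [n.AtLeastTwo] :
    IsUnit (OfNat.ofNat n : MvPolynomial (Fin 2) K13) := by
  rw [← map_ofNat C n]
  exact isUnit_C_of_ne_zero (OfNat.ofNat_ne_zero n)

theorem isUnit_tm : IsUnit tm := isUnit_C_of_ne_zero RatFunc.X_ne_zero

theorem isUnit_tm_sub_one : IsUnit (tm - 1) := by
  rw [show tm - 1 = C (RatFunc.X - 1 : K13) by simp]
  refine isUnit_C_of_ne_zero (sub_ne_zero.mpr fun h => ?_)
  rw [← RatFunc.algebraMap_X, ← map_one (algebraMap (Polynomial ℂ) (RatFunc ℂ))] at h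
  exact (Polynomial.X_ne_C 1) (RatFunc.algebraMap_injective ℂ h)

theorem stmt_13 :
    Ideal.span {xm ^ 7, xm ^ 6 * (ym - w₁₃), xm ^ 5 * (ym - w₁₃) ^ 2,
        xm ^ 4 * (ym - w₁₃) ^ 3, xm ^ 3 * (ym - w₁₃) ^ 4, xm ^ 2 * (ym - w₁₃) ^ 5,
        xm * (ym - w₁₃) ^ 6, (ym - w₁₃) ^ 7, ym ^ 2 - f₇₁₃} =
      Ideal.span
        {-4 * xm ^ 3 + (-tm ^ 4 + 6 * tm ^ 3 - 3 * tm ^ 2 - 2 * tm - 1) * xm ^ 2 +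
            (-2 * tm ^ 5 + 4 * tm ^ 4 - 2 * tm ^ 2) * xm + 4 * ym ^ 2 - tm ^ 6 +
            2 * tm ^ 5 - tm ^ 4,
          (-tm ^ 2 + 3 * tm + 3) * xm ^ 3 + 2 * xm ^ 2 * ym +
            (-3 * tm ^ 3 + 4 * tm ^ 2 + 3 * tm + 1) * xm ^ 2 + (4 * tm + 2) * xm * ym +
            (-3 * tm ^ 4 + 2 * tm ^ 3 + 2 * tm ^ 2) * xm + 2 * tm ^ 2 * ym -
            tm ^ 5 + tm ^ 4,
          2 * xm ^ 5 + (-4 * tm - 2) * xm ^ 4 + (6 * tm ^ 2 + 8 * tm + 2) * xm ^ 3 +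
            (-tm ^ 5 - 3 * tm ^ 4 + 8 * tm ^ 3 + 12 * tm ^ 2 + 6 * tm + 1) * xm ^ 2 +
            (2 * tm ^ 3 + 12 * tm ^ 2 + 10 * tm + 2) * xm * ym +
            (-2 * tm ^ 6 - 7 * tm ^ 5 + 4 * tm ^ 4 + 8 * tm ^ 3 + 2 * tm ^ 2) * xm +
            (2 * tm ^ 4 + 6 * tm ^ 3 + 2 * tm ^ 2) * ym -
            tm ^ 7 - 2 * tm ^ 6 + 2 * tm ^ 5 + tm ^ 4} := by
  set g₁ : MvPolynomial (Fin 2) K13 :=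
    -4 * xm ^ 3 + (-tm ^ 4 + 6 * tm ^ 3 - 3 * tm ^ 2 - 2 * tm - 1) * xm ^ 2 +
      (-2 * tm ^ 5 + 4 * tm ^ 4 - 2 * tm ^ 2) * xm + 4 * ym ^ 2 - tm ^ 6 +
      2 * tm ^ 5 - tm ^ 4 with hg₁
  set g₂ : MvPolynomial (Fin 2) K13 :=
    (-tm ^ 2 + 3 * tm + 3) * xm ^ 3 + 2 * xm ^ 2 * ym +
      (-3 * tm ^ 3 + 4 * tm ^ 2 + 3 * tm + 1) * xm ^ 2 + (4 * tm + 2) * xm * ym +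
      (-3 * tm ^ 4 + 2 * tm ^ 3 + 2 * tm ^ 2) * xm + 2 * tm ^ 2 * ym -
      tm ^ 5 + tm ^ 4 with hg₂
  have hF : 4 * (ym ^ 2 - f₇₁₃) = g₁ := four_mul_curve
  have hw := two_mul_w
  have hu4 : IsUnit (4 : MvPolynomial (Fin 2) K13) := isUnit_ofNat_mvPolynomial 4
  have hu2 : IsUnit (2 : MvPolynomial (Fin 2) K13) := isUnit_ofNat_mvPolynomial 2
  -- The conjugate of `g₂` under `y ↦ -y`; its product with `g₂` is `-4 x⁷` on the curve.
  let Q : MvPolynomial (Fin 2) K13 := 2 * xm ^ 2 + (4 * tm + 2) * xm + 2 * tm ^ 2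
  let g₂' : MvPolynomial (Fin 2) K13 := g₂ - 2 * Q * ym
  have norm_eq : g₂ * g₂' = -4 * xm ^ 7 - Q ^ 2 * (ym ^ 2 - f₇₁₃) := by
    refine hu4.mul_left_cancel ?_
    simp only [g₂', Q, hg₂]
    rw [hg₁] at hF
    linear_combination (2 * xm ^ 2 + (4 * tm + 2) * xm + 2 * tm ^ 2) ^ 2 * hF
  refine le_antisymm (Ideal.span_le.mpr ?_) (Ideal.span_le.mpr ?_)
  · set J := Ideal.span (_ : Set (MvPolynomial (Fin 2) K13))
    have m₁ : g₁ ∈ J := Ideal.subset_span (by simp)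
    have m₂ : g₂ ∈ J := Ideal.subset_span (by simp)
    have mF : ym ^ 2 - f₇₁₃ ∈ J := by
      rwa [← Ideal.unit_mul_mem_iff_mem J hu4, hF]
    have mx : xm ^ 7 ∈ J := by
      rw [← Ideal.unit_mul_mem_iff_mem J hu4.neg,
        show -4 * xm ^ 7 = g₂ * g₂' + Q ^ 2 * (ym ^ 2 - f₇₁₃) by rw [norm_eq]; ring]
      exact J.add_mem (J.mul_mem_right _ m₂) (J.mul_mem_left _ mF)
    have mv : 2 * tm ^ 2 * (ym - w₁₃) - xm * (-((-tm ^ 2 + 3 * tm + 3) * xm ^ 2 +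
        2 * xm * ym + (-3 * tm ^ 3 + 4 * tm ^ 2 + 3 * tm + 1) * xm + (4 * tm + 2) * ym +
        (-3 * tm ^ 4 + 2 * tm ^ 3 + 2 * tm ^ 2))) ∈ J := by
      convert m₂ using 1
      rw [hg₂]
      linear_combination -tm ^ 2 * hw
    have mon : ∀ i ≤ 7, xm ^ i * (ym - w₁₃) ^ (7 - i) ∈ J := fun i hi =>
      monomial_mem_of_pow_mem (hu2.mul (isUnit_tm.pow 2)) mx mv hi
    rintro p (rfl | rfl | rfl | rfl | rfl | rfl | rfl | rfl | rfl)
    · exact mx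
    · simpa using mon 6 (by norm_num)
    · exact mon 5 (by norm_num)
    · exact mon 4 (by norm_num)
    · exact mon 3 (by norm_num)
    · exact mon 2 (by norm_num)
    · simpa using mon 1 (by norm_num)
    · simpa using mon 0 (by norm_num)
    · exact mF
  · set I := Ideal.span (_ : Set (MvPolynomial (Fin 2) K13))
    have mon : ∀ i ≤ 7, xm ^ i * (ym - w₁₃) ^ (7 - i) ∈ I := by
      intro i hi
      apply Ideal.subset_span
      interval_cases i <;> simp
    have mF : ym ^ 2 - f₇₁₃ ∈ I := Ideal.subset_span (by simp)
    have mx : xm ^ 7 ∈ I := Ideal.subset_span (by simp)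
    have m₁ : g₁ ∈ I := hF ▸ I.mul_mem_left 4 mF
    have m₂ : g₂ ∈ I := by
      refine mem_of_mul_mem_of_monomials_mem mon (g' := g₂')
        (c := -2 * tm ^ 4 * (tm - 1))
        (a := (-tm ^ 2 + 3 * tm + 3) * xm ^ 2 +
          (-3 * tm ^ 3 + 4 * tm ^ 2 + 3 * tm + 1) * xm +
          (-3 * tm ^ 4 + 2 * tm ^ 3 + 2 * tm ^ 2) - (2 * xm + (4 * tm + 2)) * ym)
        (b := -2 * tm ^ 2) ((hu2.neg.mul (isUnit_tm.pow 4)).mul isUnit_tm_sub_one) ?_ ?_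
      · simp only [g₂', Q, hg₂]
        linear_combination -tm ^ 2 * hw
      · rw [norm_eq]
        exact I.sub_mem (I.mul_mem_left _ mx) (I.mul_mem_left _ mF)
    rintro p (rfl | rfl | rfl)
    · exact m₁
    · exact m₂
    · rw [SetLike.mem_coe, ← Ideal.unit_mul_mem_iff_mem I hu2]
      convert I.sub_mem
        (I.mul_mem_right (2 * ym + (tm ^ 2 - 3 * tm - 3) * xm +
          (tm ^ 3 + tm ^ 2 + 6 * tm + 2)) m₂)
        (I.mul_mem_right (xm ^ 2 + (2 * tm + 1) * xm + tm ^ 2) m₁) using 1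
      rw [hg₁, hg₂]
      ring
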